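/- Let d be a positive integer and let Ω ⊆ ℝ^d be a locally compact set. Then for a typical function f ∈ C(Ω) there are sets A ⊆ Ω and B ⊆ ℝ such that (i) the lower packing dimension of A is at most d−1, (ii) the Hausdorff dimension of B is 0, and (iii) the graph of f is contained in (A × ℝ) ∪ (ℝ^d × B). -/

import Mathlib

open Filter Set Topology MeasureTheory
open scoped ENNReal NNReal

noncomputable section

/-- A gauge: nondecreasing on `[0,∞)`, right-continuous, `φ 0 = 0`, positive on `(0,∞)`. -/
def IsGauge (φ : ℝ → ℝ) : Prop :=
  (∀ ⦃a b : ℝ⦄, 0 ≤ a → a ≤ b → φ a ≤ φ b) ∧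
  (∀ a : ℝ, 0 ≤ a → ContinuousWithinAt φ (Set.Ici a) a) ∧
  φ 0 = 0 ∧ (∀ r : ℝ, 0 < r → 0 < φ r)

/-- `N_δ(E)`: the least number of sets of diameter at most `δ` needed to cover `E`. -/
def coverNum {X : Type*} [PseudoMetricSpace X] (δ : ℝ) (E : Set X) : ℝ≥0∞ :=
  ⨅ (n : ℕ) (_ : ∃ F : Fin n → Set X,
    (∀ i, EMetric.diam (F i) ≤ ENNReal.ofReal δ) ∧ E ⊆ ⋃ i, F i), (n : ℝ≥0∞)

/-- `ν_0^ζ(E) = liminf_{δ→0+} N_δ(E)·ζ(δ)`. -/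
def nu0 {X : Type*} [PseudoMetricSpace X] (ζ : ℝ → ℝ) (E : Set X) : ℝ≥0∞ :=
  Filter.liminf (fun δ : ℝ => coverNum δ E * ENNReal.ofReal (ζ δ)) (𝓝[>] (0:ℝ))

/-- The lower box-counting measure `ν^ζ`. -/
def lowerBoxMeasure {X : Type*} [PseudoMetricSpace X] (ζ : ℝ → ℝ) (E : Set X) : ℝ≥0∞ :=
  ⨅ (G : ℕ → Set X) (_ : E ⊆ ⋃ n, G n), ∑' n, nu0 ζ (G n)

/-- The lower box dimension `lbdim E = liminf_{r→0+} log N_r(E)/|log r|`. -/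
def lbdim {X : Type*} [PseudoMetricSpace X] (E : Set X) : EReal :=
  Filter.liminf (fun r : ℝ => ENNReal.log (coverNum r E) * ((|Real.log r|⁻¹ : ℝ) : EReal))
    (𝓝[>] (0:ℝ))

/-- The lower packing dimension. -/
def lpdim {X : Type*} [PseudoMetricSpace X] (E : Set X) : EReal :=
  ⨅ (G : ℕ → Set X) (_ : E ⊆ ⋃ n, G n), ⨆ n, lbdim (G n)

/-- The generalized lower scaled oscillation `lip_φ f`. -/
def lipGauge {X : Type*} [PseudoMetricSpace X] (φ : ℝ → ℝ) (f : X → ℝ) (x : X) : ℝ≥0∞ :=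
  Filter.liminf
    (fun r : ℝ => EMetric.diam (f '' Metric.closedBall x r) / ENNReal.ofReal (φ r))
    (𝓝[>] (0:ℝ))

/-- The upper scaled oscillation `Lip f`. -/
def LipGauge {X : Type*} [PseudoMetricSpace X] (φ : ℝ → ℝ) (f : X → ℝ) (x : X) : ℝ≥0∞ :=
  Filter.limsup
    (fun r : ℝ => EMetric.diam (f '' Metric.closedBall x r) / ENNReal.ofReal (φ r))
    (𝓝[>] (0:ℝ))

/-- The Hausdorff measure with gauge `ξ`. -/
def hausdorffGauge {X : Type*} [PseudoMetricSpace X] (ξ : ℝ → ℝ) (E : Set X) : ℝ≥0∞ :=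
  ⨆ (δ : ℝ) (_ : 0 < δ), ⨅ (G : ℕ → Set X) (_ : E ⊆ ⋃ n, G n)
    (_ : ∀ n, EMetric.diam (G n) ≤ ENNReal.ofReal δ),
    ∑' n, ENNReal.ofReal (ξ (EMetric.diam (G n)).toReal)

/-- A box in `ℝ^k`. -/
def IsBox {k : ℕ} (S : Set (EuclideanSpace ℝ (Fin k))) : Prop :=
  ∃ a b : Fin k → ℝ, S = {x | ∀ i, x i ∈ Set.Icc (a i) (b i)}

/-- A microscopic subset of `ℝ^k`. -/
def Microscopic {k : ℕ} (X : Set (EuclideanSpace ℝ (Fin k))) : Prop :=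
  ∀ ε : ℝ, 0 < ε → ∃ B : ℕ → Set (EuclideanSpace ℝ (Fin k)),
    (∀ n, IsBox (B n)) ∧ X ⊆ ⋃ n, B n ∧
    ∀ n, MeasureTheory.volume (B n) ≤ ENNReal.ofReal (ε ^ (n + 1))

/-- A microscopic subset of `ℝ`. -/
def MicroscopicR (E : Set ℝ) : Prop :=
  ∀ ε : ℝ, 0 < ε → ∃ I : ℕ → ℝ × ℝ,
    E ⊆ ⋃ n, Set.Icc (I n).1 (I n).2 ∧
    ∀ n, MeasureTheory.volume (Set.Icc (I n).1 (I n).2) ≤ ENNReal.ofReal (ε ^ (n + 1))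

end

theorem coverNum_mono {X : Type*} [PseudoMetricSpace X] (δ : ℝ) {E F : Set X} (h : E ⊆ F) :
    coverNum δ E ≤ coverNum δ F := by
  refine le_iInf₂ fun n ⟨G, hG, hF⟩ => iInf₂_le n ⟨G, hG, h.trans hF⟩

theorem coverNum_le_card {X ι : Type*} [PseudoMetricSpace X] {δ : ℝ} {E : Set X}
    (key : X → ι) (T : Finset ι) (hT : ∀ x ∈ E, key x ∈ T)
    (hkey : ∀ x ∈ E, ∀ y ∈ E, key x = key y → dist x y ≤ δ) :
    coverNum δ E ≤ (T.card : ℝ≥0∞) := by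
  refine iInf₂_le T.card ⟨fun i => {x ∈ E | key x = T.equivFin.symm i}, fun i => ?_, fun x hx => ?_⟩
  · refine Metric.ediam_le fun x hx y hy => ?_
    rw [edist_dist]
    exact ENNReal.ofReal_le_ofReal (hkey x hx.1 y hy.1 (hx.2.trans hy.2.symm))
  · refine mem_iUnion.2 ⟨T.equivFin ⟨key x, hT x hx⟩, hx, ?_⟩
    simp

theorem lbdim_le_of_coverNum_le {X : Type*} [PseudoMetricSpace X] {E : Set X} (a : ℝ)
    (r : ℕ → ℝ) (n₀ : ℕ) (hr : ∀ n, 0 < r n ∧ r n < 1 / ((n : ℝ) + 1))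
    (hE : ∀ n, n₀ ≤ n →
      coverNum (r n) E ≤ ENNReal.ofReal (r n ^ (-(a + 1 / ((n : ℝ) + 1))))) :
    lbdim E ≤ (a : EReal) := by
  have hr0 : Tendsto r atTop (𝓝[>] 0) := by
    refine tendsto_nhdsWithin_iff.2 ⟨?_, Eventually.of_forall fun n => (hr n).1⟩
    exact squeeze_zero (fun n => (hr n).1.le) (fun n => (hr n).2.le)
      tendsto_one_div_add_atTop_nhds_zero_nat
  refine EReal.le_of_forall_lt_iff_le.1 fun c hc => ?_
  have hc' : 0 < c - a := sub_pos.2 (EReal.coe_lt_coe_iff.1 hc)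
  refine liminf_le_of_frequently_le (hr0.frequently (Eventually.frequently ?_))
  filter_upwards [eventually_ge_atTop n₀, tendsto_one_div_add_atTop_nhds_zero_nat.eventually
    (gt_mem_nhds hc')] with n hn hnc
  obtain ⟨h0, h1⟩ := hr n
  have hn1 : 1 / ((n : ℝ) + 1) ≤ 1 := by
    rw [div_le_one (by positivity)]; linarith [(Nat.cast_nonneg n : (0 : ℝ) ≤ n)]
  have hlog : Real.log (r n) < 0 := Real.log_neg h0 (h1.trans_le hn1)
  have hpos : 0 < r n ^ (-(a + 1 / ((n : ℝ) + 1))) := Real.rpow_pos_of_pos h0 _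
  have hle := ENNReal.log_monotone (hE n hn)
  rw [ENNReal.log_ofReal, if_neg (not_le.2 hpos), Real.log_rpow h0] at hle
  calc _ ≤ ((-(a + 1 / ((n : ℝ) + 1)) * Real.log (r n) : ℝ) : EReal)
        * ((|Real.log (r n)|⁻¹ : ℝ) : EReal) :=
        mul_le_mul_of_nonneg_right hle (EReal.coe_nonneg.2 (by positivity))
    _ = ((a + 1 / ((n : ℝ) + 1) : ℝ) : EReal) := by
        rw [← EReal.coe_mul, abs_of_neg hlog]
        rw [inv_neg, neg_mul, neg_mul_neg, mul_inv_cancel_right₀ hlog.ne]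
    _ ≤ (c : EReal) := EReal.coe_le_coe_iff.2 (by linarith)

theorem dimH_eq_zero_of_limsup_cover {X ι : Type*} [EMetricSpace X] [Countable ι] {B : Set X}
    (I : ℕ → ι → Set X) (hB : ∀ n, B ⊆ ⋃ k, ⋃ i, I (n + k) i)
    (hI : ∀ n : ℕ, ∑' i, Metric.ediam (I n i) ^ (1 / ((n : ℝ) + 1)) ≤ (1 / 2) ^ n) :
    dimH B = 0 := by
  borelize X
  have hone : ∀ n : ℕ, ((1 / 2 : ℝ≥0∞)) ^ n ≤ 1 := fun n => pow_le_one₀ zero_le (by simp)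
  have hle1 : ∀ n i, Metric.ediam (I n i) ≤ 1 := fun n i => by
    have h := (ENNReal.le_tsum i).trans ((hI n).trans (hone n))
    by_contra! hlt
    exact absurd (ENNReal.one_lt_rpow hlt (by positivity)) (not_lt.2 h)
  have hdiam : ∀ n i, Metric.ediam (I n i) ≤ (1 / 2) ^ n := fun n i => by
    refine le_trans ?_ ((ENNReal.le_tsum i).trans (hI n))
    conv_lhs => rw [← ENNReal.rpow_one (Metric.ediam (I n i))]
    refine ENNReal.rpow_le_rpow_of_exponent_ge (hle1 n i) ?_
    rw [div_le_one (by positivity)]; linarith [(Nat.cast_nonneg n : (0 : ℝ) ≤ n)]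
  refine le_antisymm (ENNReal.le_of_forall_pos_le_add fun t ht _ => ?_) zero_le
  rw [zero_add]
  refine dimH_le_of_hausdorffMeasure_ne_top (ne_top_of_le_ne_top (b := 2) (by simp) ?_)
  refine (Measure.hausdorffMeasure_le_liminf_tsum (ι := fun _ : ℕ => ℕ × ι) (l := atTop)
    (t : ℝ) B (fun n => (1 / 2 : ℝ≥0∞) ^ n) ?_ (fun n p => I (n + p.1) p.2) ?_ ?_).trans ?_
  · exact ENNReal.tendsto_pow_atTop_nhds_zero_of_lt_one (by simp)
  · refine Eventually.of_forall fun n p => (hdiam _ _).trans ?_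
    exact pow_le_pow_of_le_one zero_le (by simp) (Nat.le_add_right _ _)
  · refine Eventually.of_forall fun n x hx => ?_
    obtain ⟨k, hk⟩ := mem_iUnion.1 (hB n hx)
    obtain ⟨i, hi⟩ := mem_iUnion.1 hk
    exact mem_iUnion.2 ⟨(k, i), hi⟩
  · refine liminf_le_of_frequently_le (Eventually.frequently ?_)
    filter_upwards [tendsto_one_div_add_atTop_nhds_zero_nat.eventually
      (gt_mem_nhds (NNReal.coe_pos.2 ht))] with n hn
    rw [ENNReal.tsum_prod (f := fun k i => Metric.ediam (I (n + k) i) ^ (t : ℝ))]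
    calc _ ≤ ∑' k : ℕ, (1 / 2 : ℝ≥0∞) ^ k := by
          refine ENNReal.tsum_le_tsum fun k => ?_
          refine le_trans (ENNReal.tsum_le_tsum fun i => ?_) ((hI (n + k)).trans
            (pow_le_pow_of_le_one zero_le (by simp) (Nat.le_add_left k n)))
          refine ENNReal.rpow_le_rpow_of_exponent_ge (hle1 _ i) (le_trans ?_ hn.le)
          exact one_div_le_one_div_of_le (by positivity) 
            (by push_cast; linarith [(Nat.cast_nonneg k : (0 : ℝ) ≤ k)])
      _ ≤ 2 := by
          rw [ENNReal.tsum_geometric]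
          simp

/-- A continuous function `ℝ → ℝ` within distance `1` of the identity that equals the floor except
where the fractional part exceeds `1 - ρ`. -/
theorem exists_continuous_stair {ρ : ℝ} (h0 : 0 < ρ) (h1 : ρ ≤ 1) :
    ∃ σ : ℝ → ℝ, Continuous σ ∧ (∀ u, |σ u - u| ≤ 1) ∧
      ∀ u, Int.fract u ≤ 1 - ρ → σ u = ⌊u⌋ := by
  let q : ℝ → ℝ := fun y => max 0 ((y - (1 - ρ)) / ρ) - y
  have hq : Continuous q := by fun_prop
  have hq0 : q 0 = 0 := by
    have : (0 - (1 - ρ)) / ρ ≤ 0 := div_nonpos_of_nonpos_of_nonneg (by linarith) h0.le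
    simp only [q, max_eq_left this, sub_zero]
  have hq1 : q 1 = 0 := by
    have : (1 - (1 - ρ)) / ρ = 1 := by field_simp; ring
    simp only [q, this]; norm_num
  refine ⟨fun u => u + q (Int.fract u),
    continuous_id.add (hq.continuousOn.comp_fract'' (hq0.trans hq1.symm)), fun u => ?_,
    fun u hu => ?_⟩
  · have hf0 := Int.fract_nonneg u
    have hf1 := (Int.fract_lt_one u).le
    have hm : max 0 ((Int.fract u - (1 - ρ)) / ρ) ≤ 1 :=
      max_le zero_le_one ((div_le_one h0).2 (by linarith))
    have hm0 : 0 ≤ max 0 ((Int.fract u - (1 - ρ)) / ρ) := le_max_left _ _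
    simp only [q, add_sub_cancel_left]
    rw [abs_le]; constructor <;> linarith
  · have : (Int.fract u - (1 - ρ)) / ρ ≤ 0 :=
      div_nonpos_of_nonpos_of_nonneg (by linarith) h0.le
    simp only [q, max_eq_left this]
    linarith [Int.floor_add_fract u]

theorem abs_sub_le_mul_abs_fract_sub {ε u v : ℝ} (hε : 0 < ε) (h : ⌊u / ε⌋ = ⌊v / ε⌋) :
    |u - v| ≤ ε * |Int.fract (u / ε) - Int.fract (v / ε)| := by
  have hd : Int.fract (u / ε) - Int.fract (v / ε) = (u - v) / ε := by
    rw [Int.fract, Int.fract, h]; ring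
  rw [hd, abs_div, abs_of_pos hε]
  exact (mul_div_cancel₀ _ hε.ne').ge

theorem floor_div_mem_Icc {ε R t : ℝ} (hε : 0 < ε) (ht : |t| ≤ R) :
    ⌊t / ε⌋ ∈ Finset.Icc (-⌈R / ε⌉) ⌈R / ε⌉ := by
  obtain ⟨h1, h2⟩ := abs_le.1 ht
  have hc := Int.le_ceil (R / ε)
  rw [Finset.mem_Icc]
  constructor
  · rw [Int.le_floor]
    push_cast
    have : -(R / ε) ≤ t / ε := by rw [← neg_div]; gcongr
    linarith
  · have : t / ε ≤ R / ε := by gcongr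
    exact_mod_cast (Int.floor_le _).trans (this.trans hc)

theorem EuclideanSpace.dist_le_card_mul {d : ℕ} {s : ℝ} (hs : 0 ≤ s)
    {x y : EuclideanSpace ℝ (Fin d)} (h : ∀ i, |x i - y i| ≤ s) : dist x y ≤ d * s := by
  rw [EuclideanSpace.dist_eq]
  refine Real.sqrt_le_iff.2 ⟨by positivity, ?_⟩
  calc ∑ i, dist (x i) (y i) ^ 2 ≤ ∑ _i : Fin d, s ^ 2 := by
        refine Finset.sum_le_sum fun i _ => ?_
        rw [Real.dist_eq]
        exact pow_le_pow_left₀ (abs_nonneg _) (h i) 2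
    _ = d * s ^ 2 := by simp
    _ ≤ (d * s) ^ 2 := by
        rw [mul_pow]
        gcongr
        exact_mod_cast Nat.le_self_pow two_ne_zero d

/-- The part within the cube of half-side `R` of the one-sided neighbourhood, of relative width
`ρ`, of the codimension-one skeleton of the cubic grid with mesh `ε`. -/
def gridNbhd (d : ℕ) (ε ρ R : ℝ) : Set (EuclideanSpace ℝ (Fin d)) :=
  {x | (∀ i, |x i| ≤ R) ∧ ∃ i, 1 - ρ < Int.fract (x i / ε)}

theorem coverNum_gridNbhd_le (m : ℕ) {ε s R : ℝ} (hε : 0 < ε) (hs : 0 < s) :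
    coverNum (((m + 1 : ℕ) : ℝ) * s) (gridNbhd (m + 1) ε (s / ε) R) ≤
      (((m + 1) * ((Finset.Icc (-⌈R / ε⌉) ⌈R / ε⌉).card *
        (Finset.Icc (-⌈R / s⌉) ⌈R / s⌉).card ^ m) : ℕ) : ℝ≥0∞) := by
  classical
  let i₀ : EuclideanSpace ℝ (Fin (m + 1)) → Fin (m + 1) := fun x =>
    if h : ∃ i, 1 - s / ε < Int.fract (x i / ε) then h.choose else 0
  have hi₀ : ∀ x ∈ gridNbhd (m + 1) ε (s / ε) R, 1 - s / ε < Int.fract (x (i₀ x) / ε) := by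
    intro x hx
    simp only [i₀, dif_pos hx.2]
    exact hx.2.choose_spec
  refine (coverNum_le_card (fun x => (i₀ x, ⌊x (i₀ x) / ε⌋, fun j => ⌊x ((i₀ x).succAbove j) / s⌋))
    (Finset.univ ×ˢ Finset.Icc (-⌈R / ε⌉) ⌈R / ε⌉ ×ˢ
      Fintype.piFinset fun _ : Fin m => Finset.Icc (-⌈R / s⌉) ⌈R / s⌉) ?_ ?_).trans_eq ?_
  · intro x hx
    simp only [Finset.mem_product, Finset.mem_univ, true_and, Fintype.mem_piFinset]
    exact ⟨floor_div_mem_Icc hε (hx.1 _), fun j => floor_div_mem_Icc hs (hx.1 _)⟩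
  · intro x hx y hy hxy
    simp only [Prod.mk.injEq] at hxy
    obtain ⟨hi, hfl, hrest⟩ := hxy
    have hxi := hi₀ x hx
    have hyi := hi₀ y hy
    rw [← hi] at hyi hfl hrest
    refine EuclideanSpace.dist_le_card_mul hs.le fun k => ?_
    rcases Fin.eq_self_or_eq_succAbove (i₀ x) k with rfl | ⟨j, rfl⟩
    · refine (abs_sub_le_mul_abs_fract_sub hε hfl).trans ?_
      have h1 := Int.fract_lt_one (x (i₀ x) / ε)
      have h2 := Int.fract_lt_one (y (i₀ x) / ε)
      calc _ ≤ ε * (s / ε) := by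
            gcongr
            rw [abs_le]; constructor <;> linarith
        _ = s := mul_div_cancel₀ _ hε.ne'
    · refine (abs_sub_le_mul_abs_fract_sub hs (congrFun hrest j)).trans ?_
      refine mul_le_of_le_one_right hs.le ?_
      rw [abs_le]
      constructor <;> linarith [Int.fract_lt_one (x ((i₀ x).succAbove j) / s),
        Int.fract_lt_one (y ((i₀ x).succAbove j) / s), Int.fract_nonneg (x ((i₀ x).succAbove j) / s),
        Int.fract_nonneg (y ((i₀ x).succAbove j) / s)]
  · simp [Finset.card_product]

theorem card_Icc_ceil_le {R s : ℝ} (hR : 0 ≤ R) (hs : 0 < s) (hs1 : s ≤ 1) :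
    ((Finset.Icc (-⌈R / s⌉) ⌈R / s⌉).card : ℝ) ≤ (2 * R + 3) * s⁻¹ := by
  have hc : 0 ≤ ⌈R / s⌉ := Int.ceil_nonneg (by positivity)
  have hlt := Int.ceil_lt_add_one (R / s)
  have hcard : ((Finset.Icc (-⌈R / s⌉) ⌈R / s⌉).card : ℝ) = 2 * ⌈R / s⌉ + 1 := by
    rw [Int.card_Icc, ← Int.cast_natCast, Int.toNat_of_nonneg (by linarith)]
    push_cast; ring
  rw [hcard, add_mul, mul_assoc, ← div_eq_mul_inv R s]
  linarith [(one_le_inv₀ hs).2 hs1]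

/-- On a fixed cube, thin neighbourhoods of a fixed grid have the covering numbers of sets of
dimension at most `m + a`. -/
theorem exists_coverNum_gridNbhd_le (m : ℕ) {ε R a b : ℝ} (hε : 0 < ε) (hR : 0 ≤ R) (ha : 0 < a)
    (hb : 0 < b) : ∃ ρ r : ℝ, 0 < ρ ∧ ρ ≤ 1 ∧ 0 < r ∧ r < b ∧
      coverNum r (gridNbhd (m + 1) ε ρ R) ≤ ENNReal.ofReal (r ^ (-((m : ℝ) + a))) := by
  set M : ℝ := ((m + 1 : ℕ) : ℝ) with hM
  have hM0 : 0 < M := by positivity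
  set C : ℝ := M * ((Finset.Icc (-⌈R / ε⌉) ⌈R / ε⌉).card * ((2 * R + 3) * M) ^ m)
  have hev : ∀ᶠ r : ℝ in 𝓝[>] 0, r < min b (min M (M * ε)) ∧ C ≤ r ^ (-a) ∧ 0 < r :=
    ((eventually_nhdsWithin_of_eventually_nhds (gt_mem_nhds (by positivity))).and
      (((tendsto_rpow_neg_nhdsGT_zero (neg_lt_zero.2 ha)).eventually_ge_atTop C).and
        self_mem_nhdsWithin))
  obtain ⟨r, hr, hC, hr0⟩ := hev.exists
  obtain ⟨hrb, hr'⟩ := lt_min_iff.1 hr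
  obtain ⟨hrM, hrε⟩ := lt_min_iff.1 hr'
  have hs : 0 < r / M := by positivity
  have hs1 : r / M ≤ 1 := (div_le_one hM0).2 hrM.le
  refine ⟨r / M / ε, r, by positivity, ?_, hr0, hrb, ?_⟩
  · rw [div_le_one hε, div_le_iff₀ hM0, mul_comm]; exact hrε.le
  have h := coverNum_gridNbhd_le m (R := R) hε hs
  rw [← hM, mul_div_cancel₀ _ hM0.ne'] at h
  refine h.trans ?_
  rw [← ENNReal.ofReal_natCast]
  refine ENNReal.ofReal_le_ofReal ?_
  push_cast
  calc _ ≤ M * ((Finset.Icc (-⌈R / ε⌉) ⌈R / ε⌉).card * ((2 * R + 3) * (r / M)⁻¹) ^ m) := by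
        rw [hM]; push_cast
        gcongr
        have := card_Icc_ceil_le hR hs hs1
        rw [hM] at this; push_cast at this
        exact this
    _ = C * r⁻¹ ^ m := by
        rw [inv_div, div_eq_mul_inv M r, ← mul_assoc _ M, mul_pow _ r⁻¹]; ring
    _ ≤ r ^ (-a) * r⁻¹ ^ m := by gcongr
    _ = r ^ (-((m : ℝ) + a)) := by
        rw [neg_add, Real.rpow_add hr0, Real.rpow_neg hr0.le (m : ℝ), Real.rpow_natCast, inv_pow,
          mul_comm]

/-- Off a set whose covering number at some small scale is that of an almost `m`-dimensional set,
the values of `h` on `K` lie in a union of very short intervals. -/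
def IsNearlyDiscreteOn {m : ℕ} {Ω : Set (EuclideanSpace ℝ (Fin (m + 1)))} (n : ℕ) (K : Set Ω)
    (h : Ω → ℝ) : Prop :=
  ∃ (r : ℝ) (N : Set (EuclideanSpace ℝ (Fin (m + 1)))) (I : (Fin (m + 1) → ℤ) → Set ℝ),
    (0 < r ∧ r < 1 / ((n : ℝ) + 1)) ∧
    coverNum r N ≤ ENNReal.ofReal (r ^ (-((m : ℝ) + 1 / ((n : ℝ) + 1)))) ∧
    (∀ x ∈ K, (x : EuclideanSpace ℝ (Fin (m + 1))) ∉ N → h x ∈ ⋃ i, I i) ∧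
    ∑' i, Metric.ediam (I i) ^ (1 / ((n : ℝ) + 1)) ≤ (1 / 2) ^ n

theorem exists_short_intervals {ι : Type*} (T : Finset ι) (c : ι → ℝ) {a : ℝ} (ha : 0 < a)
    {δ : ℝ≥0∞} (hδ : 0 < δ) : ∃ (η : ℝ) (I : ι → Set ℝ), 0 < η ∧
      (∀ i ∈ T, ∀ y, dist y (c i) < η → y ∈ I i) ∧ ∑' i, Metric.ediam (I i) ^ a ≤ δ := by
  classical
  have ht : Tendsto (fun η : ℝ => (T.card : ℝ≥0∞) * ENNReal.ofReal (2 * η) ^ a) (𝓝[>] 0) (𝓝 0) := by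
    have h1 : Tendsto (fun η : ℝ => ENNReal.ofReal (2 * η)) (𝓝[>] 0) (𝓝 0) := by
      have : Continuous fun η : ℝ => ENNReal.ofReal (2 * η) :=
        ENNReal.continuous_ofReal.comp (by fun_prop)
      exact (this.tendsto' 0 0 (by simp)).mono_left nhdsWithin_le_nhds
    have h2 := (ENNReal.continuous_rpow_const (y := a)).continuousAt.tendsto.comp h1
    have h3 := ENNReal.Tendsto.const_mul (a := (T.card : ℝ≥0∞)) h2 (Or.inr (by simp))
    simpa [ENNReal.zero_rpow_of_pos ha] using h3
  obtain ⟨η, hη, hη0⟩ := ((ht.eventually (gt_mem_nhds hδ)).and self_mem_nhdsWithin).exists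
  refine ⟨η, fun i => if i ∈ T then Metric.closedBall (c i) η else ∅, hη0, ?_, ?_⟩
  · intro i hi y hy
    simpa only [if_pos hi] using Metric.mem_closedBall.2 hy.le
  · rw [tsum_eq_sum (s := T)]
    · refine le_trans (Finset.sum_le_card_nsmul T _ (ENNReal.ofReal (2 * η) ^ a) fun i hi => ?_) ?_
      · simp only [if_pos hi]
        rw [Real.closedBall_eq_Icc, Real.ediam_Icc]
        ring_nf
        exact le_rfl
      · rw [nsmul_eq_mul]; exact hη.le
    · intro i hi
      simp only [if_neg hi, Metric.ediam_empty, ENNReal.zero_rpow_of_pos ha]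

theorem nhds_hasBasis_compactConvergence {X : Type*} [TopologicalSpace X] (f : C(X, ℝ)) :
    (𝓝 f).HasBasis (fun p : Set X × ℝ => IsCompact p.1 ∧ 0 < p.2)
      fun p => {g : C(X, ℝ) | ∀ x ∈ p.1, dist (g x) (f x) < p.2} :=
  nhds_basis_uniformity Metric.uniformity_basis_dist.compactConvergenceUniformity

theorem isNearlyDiscreteOn_mem_residual {m : ℕ} {Ω : Set (EuclideanSpace ℝ (Fin (m + 1)))} (n : ℕ)
    {K₀ : Set Ω} (hK₀ : IsCompact K₀) :
    ∀ᶠ f : C(Ω, ℝ) in residual C(Ω, ℝ), IsNearlyDiscreteOn n K₀ f := by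
  set P : Set C(Ω, ℝ) := {f | IsNearlyDiscreteOn n K₀ f}
  suffices hP : Dense (interior P) from
    mem_of_superset (residual_of_dense_open isOpen_interior hP) interior_subset
  intro f
  rw [mem_closure_iff_nhds_basis (nhds_hasBasis_compactConvergence f)]
  rintro ⟨K₁, δ⟩ ⟨hK₁, hδ⟩
  simp only at hK₁ hδ
  set K := K₀ ∪ K₁
  have hK : IsCompact K := hK₀.union hK₁
  have : CompactSpace K := isCompact_iff_compactSpace.1 hK
  obtain ⟨F, hF⟩ := ContinuousMap.exists_extension' (Y := ℝ)
    (e := fun x : K => ((x : Ω) : EuclideanSpace ℝ (Fin (m + 1))))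
    ((continuous_subtype_val.comp continuous_subtype_val).isClosedEmbedding
      (Subtype.val_injective.comp Subtype.val_injective)) (f.restrict K)
  have hFf : ∀ x ∈ K, F x = f x := fun x hx => congrFun hF ⟨x, hx⟩
  have hK' : IsCompact ((↑) '' K : Set (EuclideanSpace ℝ (Fin (m + 1)))) :=
    hK.image continuous_subtype_val
  obtain ⟨R, hR, hKR⟩ := hK'.isBounded.exists_pos_norm_le
  obtain ⟨γ, hγ, hFγ⟩ := Metric.mem_uniformity_dist.1
    (hK'.uniformContinuousAt_of_continuousAt F (fun _ _ => F.continuous.continuousAt)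
      (Metric.dist_mem_uniformity hδ))
  obtain ⟨ε, hε, hεγ⟩ : ∃ ε : ℝ, 0 < ε ∧ ((m + 1 : ℕ) : ℝ) * ε < γ := by
    refine ⟨γ / (((m + 1 : ℕ) : ℝ) + 1), by positivity, ?_⟩
    rw [mul_div_assoc', div_lt_iff₀ (by positivity)]
    linarith
  have ha : 0 < 1 / ((n : ℝ) + 1) := by positivity
  obtain ⟨ρ, r, hρ, hρ1, hr, hrn, hcov⟩ := exists_coverNum_gridNbhd_le m hε hR.le ha ha
  obtain ⟨σ, hσ, hσ1, hσfl⟩ := exists_continuous_stair hρ hρ1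
  let φ : EuclideanSpace ℝ (Fin (m + 1)) → EuclideanSpace ℝ (Fin (m + 1)) :=
    fun x => WithLp.toLp 2 fun i => ε * σ (x i / ε)
  have hφ : Continuous φ := by fun_prop
  have hφx : ∀ x, dist x (φ x) < γ := fun x => by
    refine (EuclideanSpace.dist_le_card_mul hε.le fun i => ?_).trans_lt hεγ
    have : x i - φ x i = -(ε * (σ (x i / ε) - x i / ε)) := by
      simp only [φ]; field_simp; ring
    rw [this, abs_neg, abs_mul, abs_of_pos hε]
    exact mul_le_of_le_one_right hε.le (hσ1 _)
  let g : C(Ω, ℝ) := ⟨fun x => F (φ x), by fun_prop⟩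
  let c : (Fin (m + 1) → ℤ) → ℝ := fun k => F (WithLp.toLp 2 fun i => ε * (k i : ℝ))
  obtain ⟨η, I, hη, hIη, hIsum⟩ := exists_short_intervals
    (Fintype.piFinset fun _ : Fin (m + 1) => Finset.Icc (-⌈R / ε⌉) ⌈R / ε⌉) c ha
    (δ := (1 / 2) ^ n) (ENNReal.pow_pos (by simp) n)
  refine ⟨g, ?_, fun x hx => ?_⟩
  · rw [mem_interior_iff_mem_nhds]
    refine mem_of_superset
      ((nhds_hasBasis_compactConvergence g).mem_of_mem (i := (K₀, η)) ⟨hK₀, hη⟩) fun h hh => ?_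
    refine ⟨r, gridNbhd (m + 1) ε ρ R, I, ⟨hr, hrn⟩, hcov, fun x hx hxN => ?_, hIsum⟩
    have hxR : ∀ i, |(x : EuclideanSpace ℝ (Fin (m + 1))) i| ≤ R := fun i =>
      (PiLp.norm_apply_le (x : EuclideanSpace ℝ (Fin (m + 1))) i).trans
        (hKR _ (mem_image_of_mem _ (Or.inl hx)))
    have hfr : ∀ i, Int.fract ((x : EuclideanSpace ℝ (Fin (m + 1))) i / ε) ≤ 1 - ρ := fun i => by
      by_contra! hlt
      exact hxN ⟨hxR, i, hlt⟩
    have hgc : g x = c fun i => ⌊(x : EuclideanSpace ℝ (Fin (m + 1))) i / ε⌋ := by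
      simp only [g, c, φ, ContinuousMap.coe_mk]
      congr 2
      funext i
      rw [hσfl _ (hfr i)]
    refine mem_iUnion.2 ⟨_, hIη (fun i => ⌊(x : EuclideanSpace ℝ (Fin (m + 1))) i / ε⌋)
      (Fintype.mem_piFinset.2 fun i => floor_div_mem_Icc hε (hxR i)) _ ?_⟩
    rw [← hgc]
    exact hh x hx
  · have := hFγ (hφx x) (mem_image_of_mem _ (Or.inr hx))
    rwa [mem_ofPred_eq, dist_comm, hFf x (Or.inr hx)] at this

theorem stmt9
    (d : ℕ) (hd : 0 < d) (Ω : Set (EuclideanSpace ℝ (Fin d)))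
    (hΩ : LocallyCompactSpace Ω) :
    ∀ᶠ f : C(↥Ω, ℝ) in residual C(↥Ω, ℝ),
      ∃ (A : Set (EuclideanSpace ℝ (Fin d))) (B : Set ℝ), A ⊆ Ω ∧
        lpdim A ≤ ((d - 1 : ℕ) : EReal) ∧
        dimH B = 0 ∧
        {p : EuclideanSpace ℝ (Fin d) × ℝ | ∃ hx : p.1 ∈ Ω, p.2 = f ⟨p.1, hx⟩}
          ⊆ (A ×ˢ (Set.univ : Set ℝ)) ∪ ((Set.univ : Set (EuclideanSpace ℝ (Fin d))) ×ˢ B) := by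
  obtain ⟨m, rfl⟩ := Nat.exists_eq_add_one.2 hd
  have : SigmaCompactSpace Ω := sigmaCompactSpace_of_locallyCompact_secondCountable
  let K : CompactExhaustion Ω := default
  filter_upwards [eventually_countable_forall.2 fun n =>
    isNearlyDiscreteOn_mem_residual n (K.isCompact n)] with f hf
  choose r N I hr hN hNI hI using hf
  let G : ℕ → Set (EuclideanSpace ℝ (Fin (m + 1))) := fun k => Ω ∩ ⋂ n ≥ k, N n
  refine ⟨⋃ k, G k, {y | ∀ n, ∃ k i, y ∈ I (n + k) i}, iUnion_subset fun k => inter_subset_left,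
    iInf₂_le_of_le G subset_rfl (iSup_le fun k => ?_),
    dimH_eq_zero_of_limsup_cover I (fun n y hy => ?_) hI, ?_⟩
  · refine lbdim_le_of_coverNum_le (m : ℝ) r k hr fun n hn => ?_
    exact (coverNum_mono _ fun x hx => mem_iInter₂.1 hx.2 n hn).trans (hN n)
  · simpa only [mem_iUnion] using hy n
  · rintro ⟨x, y⟩ ⟨hx, hy⟩
    simp only at hx hy
    by_cases hA : x ∈ ⋃ k, G k
    · exact Or.inl ⟨hA, mem_univ _⟩
    refine Or.inr ⟨mem_univ _, fun n => ?_⟩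
    obtain ⟨k, hk⟩ := K.exists_mem ⟨x, hx⟩
    simp only [G, mem_iUnion, mem_inter_iff, mem_iInter, not_exists, not_and, not_forall] at hA
    obtain ⟨l, hl, hxl⟩ := hA (max n k) hx
    obtain ⟨i, hi⟩ := mem_iUnion.1 (hNI l ⟨x, hx⟩ (K.subset ((le_max_right n k).trans hl) hk) hxl)
    refine ⟨l - n, i, ?_⟩
    rw [Nat.add_sub_cancel' ((le_max_left n k).trans hl), hy]
    exact hi
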